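/- arXiv:1404.5948 — 2 statements merged into one kernel-verified Lean document; each statement's English description precedes it below -/
import Mathlib

section
/- Let L be a complete orthomodular lattice (an orthomodular lattice in which every subset has an infimum and a supremum). Then the center Z(L) is closed under arbitrary infima and arbitrary suprema: if S ⊆ Z(L), then inf S ∈ Z(L) and sup S ∈ Z(L). -/
universe u

/-- An orthomodular structure on a bounded lattice: an involutive De Morgan
orthocomplement satisfying the orthomodular law. -/
class OrthoStructure (α : Type u) [Lattice α] [BoundedOrder α] where
  ocompl : α → α
  ocompl_ocompl : ∀ x : α, ocompl (ocompl x) = x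
  ocompl_sup : ∀ x y : α, ocompl (x ⊔ y) = ocompl x ⊓ ocompl y
  inf_ocompl : ∀ x : α, x ⊓ ocompl x = ⊥
  orthomodular : ∀ x y : α, x ⊔ (ocompl x ⊓ (x ⊔ y)) = x ⊔ y

open OrthoStructure

variable {α : Type u} [Lattice α] [BoundedOrder α] [OrthoStructure α]

/-- Both distributive identities for the ordered triple `(x, y, w)`. -/
def DistribTriple (x y w : α) : Prop :=
  (x ⊔ y) ⊓ w = (x ⊓ w) ⊔ (y ⊓ w) ∧ (x ⊓ y) ⊔ w = (x ⊔ w) ⊓ (y ⊔ w)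

/-- `z` is central: both distributive identities hold for every permutation of `(a, b, z)`. -/
def IsCentral (z : α) : Prop :=
  ∀ a b : α, DistribTriple a b z ∧ DistribTriple a z b ∧ DistribTriple b a z ∧
    DistribTriple b z a ∧ DistribTriple z a b ∧ DistribTriple z b a

/-- The center `Z(α)` of an orthomodular lattice. -/
def center (α : Type u) [Lattice α] [BoundedOrder α] [OrthoStructure α] : Set α :=
  {z | IsCentral z}

theorem ocompl_antitone {x y : α} (h : x ≤ y) : ocompl y ≤ ocompl x := by
  have := ocompl_sup x y
  rw [sup_eq_right.2 h] at this
  exact this ▸ inf_le_left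

theorem le_ocompl_comm {x y : α} (h : x ≤ ocompl y) : y ≤ ocompl x := by
  simpa only [ocompl_ocompl] using ocompl_antitone h

theorem ocompl_inf (x y : α) : ocompl (x ⊓ y) = ocompl x ⊔ ocompl y := by
  rw [← ocompl_ocompl (ocompl x ⊔ ocompl y), ocompl_sup, ocompl_ocompl, ocompl_ocompl]

theorem sup_ocompl (x : α) : x ⊔ ocompl x = ⊤ := by
  refine top_unique ?_
  rw [← ocompl_ocompl (x ⊔ ocompl x), ocompl_sup, inf_ocompl]
  exact le_ocompl_comm bot_le

/-- The orthomodular law, dualized. -/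
theorem inf_sup_ocompl_le {u z : α} (h : u ≤ z) : z ⊓ (u ⊔ ocompl z) ≤ u := by
  have key := orthomodular (ocompl z) (ocompl u)
  rw [sup_eq_right.2 (ocompl_antitone h), ocompl_ocompl] at key
  have := congrArg ocompl key
  rw [ocompl_sup, ocompl_inf, ocompl_ocompl, ocompl_ocompl] at this
  rw [sup_comm]
  exact this.le

/-- The element `z` splits `a` into its parts below `z` and below `ocompl z`. -/
def Splits (z a : α) : Prop := a ≤ (a ⊓ z) ⊔ (a ⊓ ocompl z)

theorem Splits.symm {z a : α} (h : Splits z a) : Splits a z := by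
  have key := orthomodular (z ⊓ a) z
  rw [sup_eq_right.2 (inf_le_left : z ⊓ a ≤ z)] at key
  refine key.ge.trans (sup_le_sup_left (le_inf inf_le_right ?_) _)
  refine le_ocompl_comm (h.trans ?_)
  rw [ocompl_inf, ocompl_ocompl, inf_comm a z]
  exact sup_le_sup_left inf_le_right _

theorem Splits.ocompl {z a : α} (h : Splits z a) : Splits (ocompl z) a := by
  rw [Splits, ocompl_ocompl, sup_comm]
  exact h

theorem sup_inf_eq_of_splits {z : α} (h : ∀ a, Splits z a) (a b : α) :
    (a ⊔ b) ⊓ z = (a ⊓ z) ⊔ (b ⊓ z) := by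
  refine le_antisymm ?_ (sup_le (inf_le_inf_right z le_sup_left) (inf_le_inf_right z le_sup_right))
  refine le_trans ?_ (inf_sup_ocompl_le (z := z) (sup_le inf_le_right inf_le_right))
  refine le_inf inf_le_right (inf_le_left.trans (sup_le ?_ ?_))
  · exact (h a).trans (sup_le_sup le_sup_left inf_le_right)
  · exact (h b).trans (sup_le_sup le_sup_right inf_le_right)

theorem sup_inf_eq_of_splits_left {z : α} (h : ∀ a, Splits z a) (a b : α) :
    (z ⊔ a) ⊓ b = (z ⊓ b) ⊔ (a ⊓ b) := by
  refine le_antisymm ?_ (sup_le (inf_le_inf_right b le_sup_left) (inf_le_inf_right b le_sup_right))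
  refine (h _).trans (sup_le_sup (le_inf inf_le_right (inf_le_left.trans inf_le_right)) ?_)
  refine le_inf ?_ (inf_le_left.trans inf_le_right)
  refine (inf_le_inf_right _ inf_le_left).trans ?_
  rw [sup_inf_eq_of_splits (fun a => (h a).ocompl), inf_ocompl, bot_sup_eq]
  exact inf_le_left

theorem inf_sup_eq_of_splits {z : α} (h : ∀ a, Splits z a) (a b : α) :
    (a ⊓ b) ⊔ z = (a ⊔ z) ⊓ (b ⊔ z) := by
  have := congrArg ocompl
    (sup_inf_eq_of_splits (fun a => (h a).ocompl) (ocompl a) (ocompl b))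
  simpa only [ocompl_sup, ocompl_inf, ocompl_ocompl] using this

theorem inf_sup_eq_of_splits_left {z : α} (h : ∀ a, Splits z a) (a b : α) :
    (z ⊓ a) ⊔ b = (z ⊔ b) ⊓ (a ⊔ b) := by
  have := congrArg ocompl
    (sup_inf_eq_of_splits_left (fun a => (h a).ocompl) (ocompl a) (ocompl b))
  simpa only [ocompl_sup, ocompl_inf, ocompl_ocompl] using this

theorem DistribTriple.swap {γ : Type u} [Lattice γ] {x y w : γ} (h : DistribTriple x y w) :
    DistribTriple y x w := by
  rw [DistribTriple, sup_comm y x, inf_comm y x, sup_comm (y ⊓ w), inf_comm (y ⊔ w)]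
  exact h

theorem isCentral_iff_splits {z : α} : IsCentral z ↔ ∀ a, Splits z a := by
  constructor
  · intro h a
    have := (h (ocompl z) a).2.2.2.2.1.1
    rw [sup_ocompl, top_inf_eq, inf_comm z, inf_comm (ocompl z)] at this
    exact this.le
  · intro h a b
    have last (a b : α) : DistribTriple a b z :=
      ⟨sup_inf_eq_of_splits h a b, inf_sup_eq_of_splits h a b⟩
    have first (a b : α) : DistribTriple z a b :=
      ⟨sup_inf_eq_of_splits_left h a b, inf_sup_eq_of_splits_left h a b⟩
    exact ⟨last a b, (first a b).swap, last b a, (first b a).swap, first a b, first b a⟩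

theorem IsCentral.ocompl {z : α} (h : IsCentral z) : IsCentral (ocompl z) :=
  isCentral_iff_splits.2 fun a => (isCentral_iff_splits.1 h a).ocompl

theorem sSup_mem_center {β : Type u} [CompleteLattice β] [OrthoStructure β]
    {S : Set β} (hS : S ⊆ center β) : sSup S ∈ center β := by
  refine isCentral_iff_splits.2 fun a => Splits.symm (sSup_le fun z hz => ?_)
  exact (isCentral_iff_splits.1 (hS hz) a).symm.trans
    (sup_le_sup (inf_le_inf_right _ (le_sSup hz)) (inf_le_inf_right _ (le_sSup hz)))

theorem ocompl_sSup_image_ocompl {β : Type u} [CompleteLattice β] [OrthoStructure β]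
    (S : Set β) : ocompl (sSup (ocompl '' S)) = sInf S := by
  refine le_antisymm (le_sInf fun z hz => ?_) (le_ocompl_comm (sSup_le ?_))
  · simpa only [ocompl_ocompl] using ocompl_antitone (le_sSup (Set.mem_image_of_mem ocompl hz))
  · rintro _ ⟨z, hz, rfl⟩
    exact ocompl_antitone (sInf_le hz)

/-- In a complete orthomodular lattice, the center is closed under arbitrary
infima and suprema. -/
theorem center_closed_sInf_sSup {β : Type u} [CompleteLattice β] [OrthoStructure β]
    (S : Set β) (hS : S ⊆ center β) :
    sInf S ∈ center β ∧ sSup S ∈ center β := by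
  refine ⟨?_, sSup_mem_center hS⟩
  rw [← ocompl_sSup_image_ocompl]
  exact IsCentral.ocompl (sSup_mem_center (Set.image_subset_iff.2 fun z hz => (hS hz).ocompl))
end

section
/- Let L be a Boolean saturated orthomodular lattice and p ∈ L with p ∉ Z(L) (p is not central). Then the subcontrary propositions ◇p and ◇¬p are jointly satisfiable: ◇p ∧ ◇¬p ≠ 0. -/
universe u

open OrthoStructure

variable {α : Type u} [Lattice α] [BoundedOrder α] [OrthoStructure α]

/-- A Boolean saturated orthomodular lattice: every element has a smallest
central element `dia p` above it. -/
class BooleanSaturated (α : Type u) [Lattice α] [BoundedOrder α] [OrthoStructure α] where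
  dia : α → α
  dia_least : ∀ p : α, IsLeast {z : α | IsCentral z ∧ p ≤ z} (dia p)

open BooleanSaturated


/-- For a non-central proposition `p`, the subcontraries `◇p` and `◇¬p` are
jointly satisfiable: `◇p ⊓ ◇¬p ≠ ⊥`. -/
theorem square_subcontraries_compatible [BooleanSaturated α] (p : α)
    (hp : p ∉ center α) :
    dia p ⊓ dia (ocompl p) ≠ ⊥ := by
  intro h
  have hz := (dia_least p).1
  have hw := (dia_least (ocompl p)).1
  have hdisj : ocompl p ⊓ dia p = ⊥ :=
    le_bot_iff.mp (h ▸ le_inf inf_le_right (inf_le_left.trans hw.2))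
  have hom := orthomodular p (dia p)
  rw [sup_eq_right.mpr hz.2, hdisj, sup_bot_eq] at hom
  apply hp
  change IsCentral p
  rw [hom]
  exact hz.1
end
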